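/- arXiv:2603.08378 — 2 statements merged into one kernel-verified Lean document; each statement's English description precedes it below -/
import Mathlib

section
/- Let n ≥ 2 be an integer, set ξ_n = 1/(n + 1/n), b* = (n+1)^{1+1/n}/n and g(x) = x^{−1/n} + b*·x. Then for every irrational x ∈ [1/(n+1), 1], one has B_n(x) ≥ g(ξ_n). -/
open Real Set MeasureTheory
open scoped ENNReal

/-- The Gauss map `A(x) = 1/x - ⌊1/x⌋`. -/
noncomputable def gaussMap (x : ℝ) : ℝ := 1 / x - (⌊1 / x⌋ : ℝ)

/-- `brjunoBeta x j = β_{j-1}(x) = ∏_{i=0}^{j-1} A^i(x)`; in particular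
`brjunoBeta x 0 = β_{-1}(x) = 1` and `β_K(x) = brjunoBeta x (K+1)`. -/
noncomputable def brjunoBeta (x : ℝ) (j : ℕ) : ℝ := ∏ i ∈ Finset.range j, gaussMap^[i] x

/-- The σ-Brjuno function `B_σ(x) = Σ_{j≥0} β_{j-1}(x) · (A^j x)^{-1/σ}`, valued in `[0,+∞]`. -/
noncomputable def brjuno (σ x : ℝ) : ℝ≥0∞ :=
  ∑' j : ℕ, ENNReal.ofReal (brjunoBeta x j * (gaussMap^[j] x) ^ (-(1 / σ)))

/-- The K-th partial sum `B_σ^{(K)}(x) = Σ_{j=0}^{K} β_{j-1}(x) · (A^j x)^{-1/σ}`. -/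
noncomputable def brjunoPartial (σ x : ℝ) (K : ℕ) : ℝ :=
  ∑ j ∈ Finset.range (K + 1), brjunoBeta x j * (gaussMap^[j] x) ^ (-(1 / σ))

/-- The fixed point `η_m = (√(m²+4) − m)/2 = [0; m, m, m, ...]` of the Gauss map. -/
noncomputable def eta (m : ℕ) : ℝ := (Real.sqrt ((m : ℝ) ^ 2 + 4) - m) / 2

/-- `b* = (σ+1)^{1+1/σ}/σ`. -/
noncomputable def bstar (σ : ℝ) : ℝ := (σ + 1) ^ (1 + 1 / σ) / σ

/-- The global lower bound `g(x) = x^{-1/σ} + b*·x`. -/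
noncomputable def gLow (σ x : ℝ) : ℝ := x ^ (-(1 / σ)) + bstar σ * x

/-- The cylinder lower bound `g_k(x) = x^{-1/σ} + x·(1/x − k)^{-1/σ} + (1 − kx)·b*`. -/
noncomputable def gCyl (σ : ℝ) (k : ℕ) (x : ℝ) : ℝ :=
  x ^ (-(1 / σ)) + x * (1 / x - (k : ℝ)) ^ (-(1 / σ)) + (1 - (k : ℝ) * x) * bstar σ

/-- A lower bound for `x^{-1/σ}` whose weighted sum along a Gauss orbit telescopes. -/
theorem bstar_mul_one_sub_le_rpow {σ x : ℝ} (hσ : 0 < σ) (hx : 0 < x) :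
    bstar σ * (1 - x) ≤ x ^ (-(1 / σ)) := by
  have h1 : (0 : ℝ) < σ + 1 := by linarith
  have ht : 0 < (σ + 1) * x := by positivity
  have hb : 1 - 1 / σ * ((σ + 1) * x - 1) ≤ ((σ + 1) * x) ^ (-(1 / σ)) := by
    have hlog := Real.log_le_sub_one_of_pos ht
    have hexp := Real.add_one_le_exp (Real.log ((σ + 1) * x) * -(1 / σ))
    rw [Real.rpow_def_of_pos ht]
    have := mul_le_mul_of_nonneg_left hlog (by positivity : 0 ≤ 1 / σ)
    linarith
  have hpow : (0 : ℝ) < (σ + 1) ^ (1 / σ) := by positivity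
  have hs : x ^ (-(1 / σ)) = (σ + 1) ^ (1 / σ) * ((σ + 1) * x) ^ (-(1 / σ)) := by
    rw [Real.mul_rpow h1.le hx.le, ← mul_assoc, ← Real.rpow_add h1]
    simp
  have hbs : bstar σ * (1 - x) = (σ + 1) ^ (1 / σ) * (1 - 1 / σ * ((σ + 1) * x - 1)) := by
    rw [bstar, Real.rpow_add h1, Real.rpow_one]
    field_simp
    ring
  rw [hs, hbs]
  exact mul_le_mul_of_nonneg_left hb hpow.le

theorem bstar_nonneg {σ : ℝ} (hσ : 0 < σ) : 0 ≤ bstar σ := by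
  unfold bstar
  positivity

theorem bstar_le_gLow {σ x : ℝ} (hσ : 0 < σ) (hx : 0 < x) : bstar σ ≤ gLow σ x := by
  have := bstar_mul_one_sub_le_rpow hσ hx
  unfold gLow
  linarith

theorem gLow_one_div_add_one {σ : ℝ} (hσ : 0 < σ) : gLow σ (1 / (σ + 1)) = bstar σ := by
  have h1 : (0 : ℝ) < σ + 1 := by linarith
  have : (1 / (σ + 1)) ^ (-(1 / σ)) = (σ + 1) ^ (1 / σ) := by
    rw [one_div, Real.inv_rpow h1.le, Real.rpow_neg h1.le, inv_inv]
  rw [gLow, this, bstar, Real.rpow_add h1, Real.rpow_one]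
  field_simp

theorem convexOn_rpow_of_nonpos {p : ℝ} (hp : p ≤ 0) :
    ConvexOn ℝ (Set.Ioi 0) fun x : ℝ => x ^ p := by
  refine ⟨convex_Ioi 0, fun x hx y hy a b ha hb hab => ?_⟩
  have hxy : 0 < a • x + b • y := convex_Ioi (0 : ℝ) hx hy ha hb hab
  have hlog := mul_le_mul_of_nonpos_right
    (strictConcaveOn_log_Ioi.concaveOn.2 hx hy ha hb hab) hp
  have hexp := convexOn_exp.2 (Set.mem_univ (Real.log x * p)) (Set.mem_univ (Real.log y * p))
    ha hb hab
  simp only [Real.rpow_def_of_pos hxy, Real.rpow_def_of_pos hx, Real.rpow_def_of_pos hy]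
  refine (Real.exp_le_exp.2 (hlog.trans_eq ?_)).trans hexp
  simp only [smul_eq_mul]
  ring

theorem convexOn_gLow {σ : ℝ} (hσ : 0 < σ) : ConvexOn ℝ (Set.Ioi 0) (gLow σ) := by
  have hp : -(1 / σ) ≤ 0 := neg_nonpos.2 (by positivity)
  exact (convexOn_rpow_of_nonpos hp).add
    ((convexOn_id (convex_Ioi 0)).smul (bstar_nonneg hσ))

theorem gLow_monotoneOn {σ : ℝ} (hσ : 0 < σ) :
    MonotoneOn (gLow σ) (Set.Ici (1 / (σ + 1))) := by
  have h1 : (0 : ℝ) < 1 / (σ + 1) := by positivity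
  intro x hx y hy hxy
  have hx0 : 0 < x := h1.trans_le hx
  have hmin := gLow_one_div_add_one hσ
  rcases eq_or_lt_of_le (Set.mem_Ici.1 hx) with rfl | hlt
  · rw [hmin]
    exact bstar_le_gLow hσ (h1.trans_le hy)
  rcases hxy.eq_or_lt with rfl | hxy
  · exact le_rfl
  have hs := (convexOn_gLow hσ).slope_mono_adjacent h1 (hx0.trans hxy) hlt hxy
  have h0 : 0 ≤ (gLow σ x - gLow σ (1 / (σ + 1))) / (x - 1 / (σ + 1)) :=
    div_nonneg (by rw [hmin]; linarith [bstar_le_gLow hσ hx0]) (by linarith)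
  have h2 := h0.trans hs
  rw [le_div_iff₀ (by linarith)] at h2
  linarith

theorem gaussMap_mem_Ioo {x : ℝ} (hx : Irrational x) : gaussMap x ∈ Set.Ioo (0 : ℝ) 1 := by
  have hfr : gaussMap x = Int.fract (1 / x) := rfl
  have hirr : Irrational (1 / x) := by simpa using hx.inv
  refine ⟨?_, hfr ▸ Int.fract_lt_one _⟩
  refine lt_of_le_of_ne (hfr ▸ Int.fract_nonneg _) fun h => ?_
  exact hirr.ne_int ⌊1 / x⌋ (by unfold gaussMap at h; linarith)

theorem irrational_gaussMap {x : ℝ} (hx : Irrational x) : Irrational (gaussMap x) := by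
  have hirr : Irrational (1 / x) := by simpa using hx.inv
  exact hirr.sub_intCast _

theorem irrational_iterate_gaussMap {x : ℝ} (hx : Irrational x) (j : ℕ) :
    Irrational (gaussMap^[j] x) := by
  induction j with
  | zero => exact hx
  | succ j ih =>
    rw [Function.iterate_succ_apply']
    exact irrational_gaussMap ih

theorem iterate_gaussMap_mem_Ioo {x : ℝ} (hx : Irrational x) (hx01 : x ∈ Set.Ioo (0 : ℝ) 1)
    (j : ℕ) : gaussMap^[j] x ∈ Set.Ioo (0 : ℝ) 1 := by
  cases j with
  | zero => exact hx01
  | succ j =>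
    rw [Function.iterate_succ_apply']
    exact gaussMap_mem_Ioo (irrational_iterate_gaussMap hx j)

theorem brjunoBeta_pos {x : ℝ} (hx : Irrational x) (hx01 : x ∈ Set.Ioo (0 : ℝ) 1) (j : ℕ) :
    0 < brjunoBeta x j :=
  Finset.prod_pos fun i _ => (iterate_gaussMap_mem_Ioo hx hx01 i).1

theorem brjunoBeta_succ (x : ℝ) (j : ℕ) :
    brjunoBeta x (j + 1) = brjunoBeta x j * gaussMap^[j] x :=
  Finset.prod_range_succ _ _

theorem brjunoBeta_succ' (x : ℝ) (j : ℕ) :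
    brjunoBeta x (j + 1) = x * brjunoBeta (gaussMap x) j := by
  rw [brjunoBeta, Finset.prod_range_succ', mul_comm]
  rfl

theorem brjuno_eq_add {x : ℝ} (σ : ℝ) (hx : 0 ≤ x) :
    brjuno σ x = ENNReal.ofReal (x ^ (-(1 / σ))) + ENNReal.ofReal x * brjuno σ (gaussMap x) := by
  rw [brjuno, tsum_eq_zero_add' ENNReal.summable, brjuno, ← ENNReal.tsum_mul_left]
  congr 1
  · simp [brjunoBeta]
  · refine tsum_congr fun j => ?_
    rw [brjunoBeta_succ', mul_assoc, ENNReal.ofReal_mul hx, Function.iterate_succ_apply]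

theorem bstar_le_brjuno {σ x : ℝ} (hσ : 0 < σ) (hx : Irrational x)
    (hx01 : x ∈ Set.Ioo (0 : ℝ) 1) : ENNReal.ofReal (bstar σ) ≤ brjuno σ x := by
  by_cases htop : brjuno σ x = ⊤
  · simp [htop]
  set f : ℕ → ℝ := fun j => brjunoBeta x j * (gaussMap^[j] x) ^ (-(1 / σ)) with hf
  have hpos := brjunoBeta_pos hx hx01
  have hI := iterate_gaussMap_mem_Ioo hx hx01
  have hf0 : ∀ j, 0 ≤ f j := fun j =>
    mul_nonneg (hpos j).le (Real.rpow_nonneg (hI j).1.le _)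
  have hβf : ∀ j, brjunoBeta x j ≤ f j := fun j =>
    le_mul_of_one_le_right (hpos j).le
      (Real.one_le_rpow_of_pos_of_le_one_of_nonpos (hI j).1 (hI j).2.le
        (neg_nonpos.2 (by positivity)))
  have hsum : Summable f := by
    have := ENNReal.summable_toReal htop
    refine this.congr fun j => ?_
    exact ENNReal.toReal_ofReal (hf0 j)
  have hβ : Filter.Tendsto (brjunoBeta x) Filter.atTop (nhds 0) :=
    squeeze_zero (fun j => (hpos j).le) hβf hsum.tendsto_atTop_zero
  have hpart : ∀ K, bstar σ * (1 - brjunoBeta x K) ≤ ∑ j ∈ Finset.range K, f j := by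
    intro K
    induction K with
    | zero => simp [brjunoBeta]
    | succ K ih =>
      rw [Finset.sum_range_succ, brjunoBeta_succ]
      have := mul_le_mul_of_nonneg_left (bstar_mul_one_sub_le_rpow hσ (hI K).1) (hpos K).le
      simp only [hf] at ih ⊢
      linarith
  have hlim : Filter.Tendsto (fun K => bstar σ * (1 - brjunoBeta x K)) Filter.atTop
      (nhds (bstar σ)) := by
    simpa using (hβ.const_sub 1).const_mul (bstar σ)
  have hle : bstar σ ≤ ∑' j, f j :=
    le_of_tendsto_of_tendsto' hlim hsum.hasSum.tendsto_sum_nat hpart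
  calc ENNReal.ofReal (bstar σ) ≤ ENNReal.ofReal (∑' j, f j) := ENNReal.ofReal_le_ofReal hle
    _ = brjuno σ x := ENNReal.ofReal_tsum_of_nonneg hf0 hsum

theorem ofReal_add_mul_le_brjuno {σ x c : ℝ} (hx : 0 < x)
    (h : ENNReal.ofReal c ≤ brjuno σ (gaussMap x)) :
    ENNReal.ofReal (x ^ (-(1 / σ)) + c * x) ≤ brjuno σ x := by
  rw [brjuno_eq_add σ hx.le]
  refine ENNReal.ofReal_add_le.trans ?_
  rw [mul_comm c, ENNReal.ofReal_mul hx.le]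
  gcongr

theorem gLow_le_brjuno {σ x : ℝ} (hσ : 0 < σ) (hx : Irrational x) (hx0 : 0 < x) :
    ENNReal.ofReal (gLow σ x) ≤ brjuno σ x :=
  ofReal_add_mul_le_brjuno hx0
    (bstar_le_brjuno hσ (irrational_gaussMap hx) (gaussMap_mem_Ioo hx))

/-- The convexity estimate behind the lower bound on the cylinder of points `1 / (σ + y)`. -/
theorem gLow_le_rpow_add_gLow_mul {σ y : ℝ} (hσ : 1 ≤ σ) (hy : 1 / σ < y) :
    gLow σ (1 / (σ + 1 / σ)) ≤
      (1 / (σ + y)) ^ (-(1 / σ)) + gLow σ y * (1 / (σ + y)) := by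
  have hσ0 : 0 < σ := by linarith
  have ha : 0 < 1 / σ := by positivity
  have hy0 : 0 < y := ha.trans hy
  set ξ := 1 / (σ + 1 / σ) with hξ
  set x := 1 / (σ + y) with hxdef
  have hx0 : 0 < x := by positivity
  have hξ0 : 0 < ξ := by positivity
  have hxξ : x < ξ := one_div_lt_one_div_of_lt (by positivity) (by linarith)
  have hξa : ξ < 1 / σ := one_div_lt_one_div_of_lt hσ0 (by linarith)
  have hξ1 : ξ ≤ 1 := hξa.le.trans (by rw [div_le_one hσ0]; exact hσ)
  have hc := convexOn_gLow hσ0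
  have hslope := (hc.slope_mono_adjacent hx0 ha hxξ hξa).trans
    (hc.slope_mono_adjacent hξ0 hy0 hξa hy)
  set s := (gLow σ y - gLow σ (1 / σ)) / (y - 1 / σ) with hs
  have hsy : gLow σ y - gLow σ (1 / σ) = s * (y - 1 / σ) := by
    rw [hs, div_mul_cancel₀ _ (by linarith)]
  have hmono : gLow σ (1 / σ) ≤ gLow σ y := by
    have h1 : 1 / (σ + 1) ≤ 1 / σ := one_div_le_one_div_of_le hσ0 (by linarith)
    exact gLow_monotoneOn hσ0 h1 (h1.trans hy.le) hy.le
  rw [div_le_iff₀ (by linarith)] at hslope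
  have hdiff : ξ - x = ξ * (x * (y - 1 / σ)) := by
    rw [hξ, hxdef]
    field_simp
    ring
  have hstep : s * (ξ - x) ≤ x * (gLow σ y - gLow σ (1 / σ)) := by
    have h0 : 0 ≤ x * (gLow σ y - gLow σ (1 / σ)) := mul_nonneg hx0.le (by linarith)
    calc s * (ξ - x) = ξ * (x * (gLow σ y - gLow σ (1 / σ))) := by rw [hdiff, hsy]; ring
      _ ≤ x * (gLow σ y - gLow σ (1 / σ)) := mul_le_of_le_one_left h0 hξ1
  have hb := mul_le_mul_of_nonneg_left (bstar_le_gLow hσ0 ha) hx0.le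
  have hgx : gLow σ x = x ^ (-(1 / σ)) + bstar σ * x := rfl
  linarith

/-- for `n ≥ 2` and every irrational `x ∈ [1/(n+1), 1]`,
`B_n(x) ≥ g(ξ_n)` where `ξ_n = 1/(n + 1/n)`. -/
theorem brjuno_ge_g_xi (n : ℕ) (hn : 2 ≤ n) (x : ℝ) (hx : Irrational x)
    (hx01 : x ∈ Set.Icc (1 / ((n : ℝ) + 1)) 1) :
    ENNReal.ofReal (gLow n (1 / ((n : ℝ) + 1 / (n : ℝ)))) ≤ brjuno n x := by
  have hn1 : (1 : ℝ) ≤ n := by exact_mod_cast (by omega : 1 ≤ n)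
  have hn0 : (0 : ℝ) < n := by linarith
  have ha : (0 : ℝ) < 1 / n := by positivity
  have ha1 : (1 : ℝ) / n ≤ 1 := by rw [div_le_one hn0]; exact hn1
  have hx0 : 0 < x := lt_of_lt_of_le (by positivity) hx01.1
  rcases le_or_gt (1 / ((n : ℝ) + 1 / n)) x with hξx | hxξ
  · refine (ENNReal.ofReal_le_ofReal ?_).trans (gLow_le_brjuno hn0 hx hx0)
    have hξ : 1 / ((n : ℝ) + 1) ≤ 1 / ((n : ℝ) + 1 / n) :=
      one_div_le_one_div_of_le (by positivity) (by linarith)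
    exact gLow_monotoneOn hn0 hξ hx01.1 hξx
  have hlo : (n : ℝ) + 1 / n < 1 / x := (lt_one_div (by positivity) hx0).2 hxξ
  have hhi : 1 / x < (n : ℝ) + 1 := by
    refine lt_of_le_of_ne ((one_div_le hx0 (by positivity)).2 hx01.1) fun h => ?_
    have hirr : Irrational (1 / x) := by simpa using hx.inv
    exact hirr.ne_nat (n + 1) (by push_cast; exact h)
  have hfloor : ⌊1 / x⌋ = (n : ℤ) := by
    rw [Int.floor_eq_iff]
    constructor <;> push_cast <;> linarith
  have hgm : gaussMap x = 1 / x - n := by rw [gaussMap, hfloor, Int.cast_natCast]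
  have hxy : 1 / ((n : ℝ) + gaussMap x) = x := by rw [hgm]; simp
  have hmain := gLow_le_rpow_add_gLow_mul hn1 (y := gaussMap x) (by rw [hgm]; linarith)
  rw [hxy] at hmain
  refine (ENNReal.ofReal_le_ofReal hmain).trans (ofReal_add_mul_le_brjuno hx0 ?_)
  exact gLow_le_brjuno hn0 (irrational_gaussMap hx) (gaussMap_mem_Ioo hx).1
end

section
/- Let n ≥ 2 be an integer, set ξ_n = 1/(n + 1/n), b* = (n+1)^{1+1/n}/n, g(x) = x^{−1/n} + b*·x, and η_{n+1} = (√((n+1)²+4) − (n+1))/2. Then g(ξ_n) > B_n(η_{n+1}), where B_n(η_{n+1}) = η_{n+1}^{−1/n}/(1 − η_{n+1}). -/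
open Real Set MeasureTheory
open scoped ENNReal

theorem eta_sq_add (m : ℕ) : eta m ^ 2 + m * eta m = 1 := by
  have h := Real.sq_sqrt (show (0 : ℝ) ≤ (m : ℝ) ^ 2 + 4 by positivity)
  unfold eta
  linear_combination h / 4

theorem eta_pos (m : ℕ) : 0 < eta m := by
  have h : (m : ℝ) < √((m : ℝ) ^ 2 + 4) := Real.lt_sqrt_of_sq_lt (by linarith)
  unfold eta
  linarith

theorem eta_lt_one {m : ℕ} (hm : 1 ≤ m) : eta m < 1 := by
  have h₁ : (1 : ℝ) ≤ m := by exact_mod_cast hm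
  nlinarith [eta_sq_add m, eta_pos m]

theorem inv_eta (m : ℕ) : (eta m)⁻¹ = m + eta m := by
  have h := eta_pos m
  field_simp
  linarith [eta_sq_add m]

theorem gaussMap_eta {m : ℕ} (hm : 1 ≤ m) : gaussMap (eta m) = eta m := by
  have hfloor : ⌊(m : ℝ) + eta m⌋ = m := by
    rw [Int.floor_eq_iff]
    push_cast
    exact ⟨by linarith [eta_pos m], by linarith [eta_lt_one hm]⟩
  rw [gaussMap, one_div, inv_eta, hfloor]
  push_cast
  ring

theorem brjuno_of_gaussMap_eq_self {x : ℝ} (hx : gaussMap x = x) (h₀ : 0 < x) (h₁ : x < 1)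
    (σ : ℝ) : brjuno σ x = ENNReal.ofReal (x ^ (-(1 / σ)) / (1 - x)) := by
  have hiter (j : ℕ) : gaussMap^[j] x = x := Function.iterate_fixed hx j
  simp only [brjuno, brjunoBeta, hiter, Finset.prod_const, Finset.card_range]
  rw [← ENNReal.ofReal_tsum_of_nonneg (fun j ↦ by positivity)
    ((summable_geometric_of_lt_one h₀.le h₁).mul_right _), tsum_mul_right,
    tsum_geometric_of_lt_one h₀.le h₁, inv_mul_eq_div]

theorem log_le_half_sub_inv {r : ℝ} (hr : 1 ≤ r) : Real.log r ≤ (r - r⁻¹) / 2 := by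
  rw [← Real.sinh_log (by linarith)]
  exact Real.self_le_sinh_iff.2 (Real.log_nonneg hr)

theorem one_sub_le_inv_rpow {r p : ℝ} (hr : 1 ≤ r) (hp : 0 ≤ p) :
    1 - p * ((r - r⁻¹) / 2) ≤ r⁻¹ ^ p := by
  have hr₀ : 0 < r := by linarith
  rw [Real.rpow_def_of_pos (inv_pos.2 hr₀), Real.log_inv]
  nlinarith [Real.add_one_le_exp (-Real.log r * p),
    mul_le_mul_of_nonneg_left (log_le_half_sub_inv hr) hp]

/-- The rational upper bound for the root of `y ^ 2 + (x + 1) * y = 1` used in the comparison. -/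
theorem lt_rational_bound {x y : ℝ} (hx : 2 ≤ x) (h : y ^ 2 + (x + 1) * y = 1) :
    y * (2 * x ^ 2 * (x + 1) * (x ^ 2 + 1) + (2 * x ^ 4 + 2 * x ^ 3 + 3 * x ^ 2 + 1)
      + 2 * x * (x ^ 2 + 1)) < 2 * x ^ 4 + 2 * x ^ 3 + 3 * x ^ 2 + 1 := by
  set a := 2 * x ^ 4 + 2 * x ^ 3 + 3 * x ^ 2 + 1 with ha
  set c := 2 * x ^ 2 * (x + 1) * (x ^ 2 + 1) + a + 2 * x * (x ^ 2 + 1) with hc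
  have ha₀ : 0 < a := by positivity
  have hc₀ : 0 < c := by positivity
  have key : 0 < a ^ 2 + (x + 1) * (a * c) - c ^ 2 := by
    obtain ⟨m, rfl⟩ : ∃ m, x = m + 2 := ⟨x - 2, by ring⟩
    have hm : 0 ≤ m := by linarith
    have : a ^ 2 + (m + 2 + 1) * (a * c) - c ^ 2 = 103 + 1103 * m + 2710 * m ^ 2 + 3178 * m ^ 3
        + 2145 * m ^ 4 + 887 * m ^ 5 + 224 * m ^ 6 + 32 * m ^ 7 + 2 * m ^ 8 := by
      rw [hc, ha]; ring
    rw [this]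
    positivity
  by_contra! hle
  have h₁ : a ^ 2 ≤ (y * c) ^ 2 := pow_le_pow_left₀ ha₀.le hle 2
  have h₂ : (x + 1) * (a * c) ≤ (x + 1) * (y * c * c) := by gcongr
  have h₃ : (y * c) ^ 2 + (x + 1) * (y * c * c) = c ^ 2 := by
    linear_combination c ^ 2 * h
  linarith

theorem rational_comparison {x y : ℝ} (hx : 2 ≤ x) (hy : 0 < y) (hy₁ : y < 1)
    (h : y ^ 2 + (x + 1) * y = 1) :
    (1 + 1 / x * (y / (x + 1))) / (1 - y) <
      1 - 1 / x * ((x * (x + 1) / (x ^ 2 + 1) - (x * (x + 1) / (x ^ 2 + 1))⁻¹) / 2)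
        + (x + 1) / (x ^ 2 + 1) := by
  have hx₀ : 0 < x := by linarith
  rw [div_lt_iff₀ (by linarith), ← sub_pos]
  have hD : 0 < 2 * x ^ 2 * (x + 1) * (x ^ 2 + 1) := by positivity
  refine lt_of_lt_of_eq (div_pos (sub_pos.2 (lt_rational_bound hx h)) hD) ?_
  field_simp
  ring

theorem real_comparison (n : ℕ) (hn : 2 ≤ n) :
    eta (n + 1) ^ (-(1 / (n : ℝ))) / (1 - eta (n + 1)) <
      gLow n (1 / ((n : ℝ) + 1 / (n : ℝ))) := by
  have hx : (2 : ℝ) ≤ n := by exact_mod_cast hn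
  have hy := eta_pos (n + 1)
  have hy₁ := eta_lt_one (m := n + 1) (by omega)
  have hquad := eta_sq_add (n + 1)
  have hinv := inv_eta (n + 1)
  push_cast at hquad hinv
  set y := eta (n + 1)
  set x : ℝ := (n : ℝ)
  have hx₀ : 0 < x := by linarith
  set r := x * (x + 1) / (x ^ 2 + 1) with hr
  have hr₁ : 1 ≤ r := by rw [hr, one_le_div (by positivity)]; linarith
  have hr₀ : 0 < r := by linarith
  have hp : 0 ≤ 1 / x := by positivity
  have hp₁ : 1 / x ≤ 1 := by rw [div_le_one hx₀]; linarith
  have hleft : y ^ (-(1 / x)) ≤ (x + 1) ^ (1 / x) * (1 + 1 / x * (y / (x + 1))) := by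
    rw [Real.rpow_neg hy.le, ← Real.inv_rpow hy.le, hinv,
      show x + 1 + y = (x + 1) * (1 + y / (x + 1)) by field_simp,
      Real.mul_rpow (by positivity) (by positivity)]
    gcongr
    exact rpow_one_add_le_one_add_mul_self (by linarith [div_pos hy (by positivity : 0 < x + 1)])
      hp hp₁
  have hright : gLow x (1 / (x + 1 / x)) =
      (x + 1) ^ (1 / x) * (r⁻¹ ^ (1 / x) + (x + 1) / (x ^ 2 + 1)) := by
    have h₁ : (1 / (x + 1 / x)) ^ (-(1 / x)) = (x + 1) ^ (1 / x) * r⁻¹ ^ (1 / x) := by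
      rw [Real.rpow_neg (by positivity), ← Real.inv_rpow (by positivity),
        ← Real.mul_rpow (by positivity) (by positivity)]
      congr 1
      rw [hr]
      field_simp
    rw [gLow, h₁, bstar, Real.rpow_add (by positivity), Real.rpow_one]
    field_simp
  rw [hright]
  have hy₂ : 0 < 1 - y := by linarith
  calc y ^ (-(1 / x)) / (1 - y)
      ≤ (x + 1) ^ (1 / x) * (1 + 1 / x * (y / (x + 1))) / (1 - y) := by gcongr
    _ = (x + 1) ^ (1 / x) * ((1 + 1 / x * (y / (x + 1))) / (1 - y)) := by ring
    _ < (x + 1) ^ (1 / x) * (r⁻¹ ^ (1 / x) + (x + 1) / (x ^ 2 + 1)) := by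
      refine mul_lt_mul_of_pos_left ?_ (by positivity)
      linarith [rational_comparison hx hy hy₁ hquad, one_sub_le_inv_rpow hr₁ hp]

/-- for `n ≥ 2`, `g(ξ_n) > B_n(η_{n+1}) = η_{n+1}^{−1/n}/(1 − η_{n+1})`. -/
theorem g_xi_gt_brjuno_eta (n : ℕ) (hn : 2 ≤ n) :
    brjuno n (eta (n + 1)) =
      ENNReal.ofReal (eta (n + 1) ^ (-(1 / (n : ℝ))) / (1 - eta (n + 1))) ∧
    ENNReal.ofReal (eta (n + 1) ^ (-(1 / (n : ℝ))) / (1 - eta (n + 1))) <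
      ENNReal.ofReal (gLow n (1 / ((n : ℝ) + 1 / (n : ℝ)))) := by
  have h₀ := eta_pos (n + 1)
  have h₁ := eta_lt_one (m := n + 1) (by omega)
  refine ⟨brjuno_of_gaussMap_eq_self (gaussMap_eta (by omega)) h₀ h₁ n, ?_⟩
  have hB : 0 < eta (n + 1) ^ (-(1 / (n : ℝ))) / (1 - eta (n + 1)) :=
    div_pos (Real.rpow_pos_of_pos h₀ _) (by linarith)
  have h := real_comparison n hn
  exact (ENNReal.ofReal_lt_ofReal_iff (hB.trans h)).2 h
end
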